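/- There exists an absolute constant C > 0 such that for all real u with |u| ≤ 1 and all x ∈ ℝ, |Φ(x(1 + u²)^{1/2} − u) − [Φ(x) + (−u + (1/6)u³(2x² + 1) + (1/12)u⁴ x(x² − 3)) φ(x)]| ≤ C|u|⁵. -/

import Mathlib

open MeasureTheory Set

noncomputable section

/-- The standard normal density `φ`. -/
def gaussPDF (x : ℝ) : ℝ := (Real.sqrt (2 * Real.pi))⁻¹ * Real.exp (-x ^ 2 / 2)

/-- The standard normal distribution function `Φ`. -/
def gaussCDF (x : ℝ) : ℝ := ∫ t in Set.Iic x, gaussPDF t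

lemma gaussPDF_pos (x : ℝ) : 0 < gaussPDF x := by
  unfold gaussPDF; positivity

lemma continuous_gaussPDF : Continuous gaussPDF := by
  unfold gaussPDF; fun_prop

lemma integrable_gaussPDF : Integrable gaussPDF := by
  have h := (integrable_exp_neg_mul_sq (b := 1 / 2) (by norm_num)).const_mul
    (Real.sqrt (2 * Real.pi))⁻¹
  refine h.congr (Filter.Eventually.of_forall fun x => ?_)
  simp only [gaussPDF]
  congr 2
  ring

lemma hasDerivAt_gaussPDF (x : ℝ) : HasDerivAt gaussPDF (-x * gaussPDF x) x := by
  have h := (((hasDerivAt_pow 2 x).neg.div_const 2).exp).const_mul (Real.sqrt (2 * Real.pi))⁻¹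
  refine h.congr_deriv ?_
  simp only [gaussPDF, Pi.neg_apply]
  push_cast
  ring

lemma hasDerivAt_gaussCDF (x : ℝ) : HasDerivAt gaussCDF (gaussPDF x) x := by
  have h : gaussCDF = fun y => (∫ t in (0 : ℝ)..y, gaussPDF t) + gaussCDF 0 := by
    funext y
    rw [← intervalIntegral.integral_Iic_sub_Iic integrable_gaussPDF.integrableOn
      integrable_gaussPDF.integrableOn]
    simp only [gaussCDF]
    ring
  rw [h]
  exact (intervalIntegral.integral_hasDerivAt_right
    (continuous_gaussPDF.intervalIntegrable _ _)
    (continuous_gaussPDF.stronglyMeasurableAtFilter _ _) continuous_gaussPDF.continuousAt).add_const _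

lemma one_add_abs_pow_mul_gaussPDF_le (n : ℕ) (x : ℝ) :
    (1 + |x|) ^ n * gaussPDF x ≤ Real.exp (n ^ 2 / 2) := by
  have h1 : (1 + |x|) ^ n ≤ Real.exp (n * |x|) := by
    rw [Real.exp_nat_mul]
    gcongr
    linarith [Real.add_one_le_exp |x|]
  have h2 : (Real.sqrt (2 * Real.pi))⁻¹ ≤ 1 :=
    inv_le_one_of_one_le₀ (Real.one_le_sqrt.2 (by linarith [Real.pi_gt_three]))
  have h3 : gaussPDF x ≤ Real.exp (-x ^ 2 / 2) :=
    mul_le_of_le_one_left (Real.exp_pos _).le h2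
  calc (1 + |x|) ^ n * gaussPDF x ≤ Real.exp (n * |x|) * Real.exp (-x ^ 2 / 2) :=
        mul_le_mul h1 h3 (gaussPDF_pos x).le (Real.exp_pos _).le
    _ = Real.exp (n * |x| + -x ^ 2 / 2) := (Real.exp_add _ _).symm
    _ ≤ Real.exp (n ^ 2 / 2) := Real.exp_le_exp.2 (by
        nlinarith [sq_nonneg ((n : ℝ) - |x|), sq_abs x])

lemma abs_le_mul_abs_pow_succ {f g : ℝ → ℝ} {C r : ℝ} (n : ℕ) (hC : 0 ≤ C) (h0 : f 0 = 0)
    (hf : ∀ t, HasDerivAt f (g t) t) (hg : ∀ t, |t| ≤ r → |g t| ≤ C * |t| ^ n) :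
    ∀ t, |t| ≤ r → |f t| ≤ C * |t| ^ (n + 1) := by
  intro t ht
  have key := Convex.norm_image_sub_le_of_norm_hasDerivWithin_le (f := f) (f' := g)
    (s := uIcc 0 t) (x := 0) (y := t) (C := C * |t| ^ n)
    (fun s _ => (hf s).hasDerivWithinAt)
    (fun s hs => by
      have hst : |s| ≤ |t| := by simpa using abs_sub_left_of_mem_uIcc hs
      exact (hg s (hst.trans ht)).trans (by gcongr))
    (convex_uIcc 0 t) left_mem_uIcc right_mem_uIcc
  simpa [h0, pow_succ, mul_assoc] using key

lemma abs_mul_sinh_sub_cosh_le (x t : ℝ) :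
    |x * Real.sinh t - Real.cosh t| ≤ 1 + |x * Real.cosh t - Real.sinh t| := by
  have hc := Real.one_le_cosh t
  have hc0 := Real.cosh_pos t
  have hs : |Real.sinh t| ≤ Real.cosh t :=
    abs_le_of_sq_le_sq (by linarith [Real.cosh_sq t]) hc0.le
  have h : Real.cosh t * (x * Real.sinh t - Real.cosh t)
      = Real.sinh t * (x * Real.cosh t - Real.sinh t) - 1 := by
    linear_combination -Real.cosh_sq t
  refine le_of_mul_le_mul_left ?_ hc0
  calc Real.cosh t * |x * Real.sinh t - Real.cosh t|
      = |Real.sinh t * (x * Real.cosh t - Real.sinh t) - 1| := by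
        rw [← h, abs_mul, abs_of_pos hc0]
    _ ≤ |Real.sinh t| * |x * Real.cosh t - Real.sinh t| + 1 := by
        rw [← abs_mul]
        simpa using abs_sub (Real.sinh t * (x * Real.cosh t - Real.sinh t)) 1
    _ ≤ Real.cosh t * |x * Real.cosh t - Real.sinh t| + Real.cosh t := by gcongr
    _ = _ := by ring

/-- The fifth derivative of `t ↦ Φ (x cosh t - sinh t)` is `φ y` times this polynomial, where
`y = x cosh t - sinh t` and `z = x sinh t - cosh t`. -/
lemma abs_quintic_le {y z m : ℝ} (hm : 1 ≤ m) (hy : |y| ≤ m) (hz : |z| ≤ m) :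
    |z - 10 * z ^ 3 + 3 * z ^ 5 - 30 * y ^ 2 * z + 40 * y ^ 2 * z ^ 3 - 6 * y ^ 2 * z ^ 5
      + 15 * y ^ 4 * z - 10 * y ^ 4 * z ^ 3 + y ^ 4 * z ^ 5| ≤ 116 * m ^ 9 := by
  have mono : ∀ i j : ℕ, i + j ≤ 9 → |y ^ i * z ^ j| ≤ m ^ 9 := fun i j hij => by
    rw [abs_mul, abs_pow, abs_pow]
    calc |y| ^ i * |z| ^ j ≤ m ^ i * m ^ j := by gcongr
      _ = m ^ (i + j) := (pow_add _ _ _).symm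
      _ ≤ m ^ 9 := pow_le_pow_right₀ hm hij
  have h1 := abs_le.1 (mono 0 1 (by norm_num))
  have h2 := abs_le.1 (mono 0 3 (by norm_num))
  have h3 := abs_le.1 (mono 0 5 (by norm_num))
  have h4 := abs_le.1 (mono 2 1 (by norm_num))
  have h5 := abs_le.1 (mono 2 3 (by norm_num))
  have h6 := abs_le.1 (mono 2 5 (by norm_num))
  have h7 := abs_le.1 (mono 4 1 (by norm_num))
  have h8 := abs_le.1 (mono 4 3 (by norm_num))
  have h9 := abs_le.1 (mono 4 5 (by norm_num))
  simp only [pow_zero, one_mul, pow_one] at *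
  rw [abs_le]
  constructor <;> linarith

lemma hasDerivAt_gaussPDF_mul {y z q : ℝ → ℝ} {q' t : ℝ} (hy : HasDerivAt y (z t) t)
    (hq : HasDerivAt q q' t) :
    HasDerivAt (fun s => gaussPDF (y s) * q s) (gaussPDF (y t) * (q' - y t * z t * q t)) t := by
  refine (((hasDerivAt_gaussPDF (y t)).comp t hy).mul hq).congr_deriv ?_
  simp only [Function.comp_apply]
  ring

lemma abs_sinh_le_two {t : ℝ} (ht : |t| ≤ 1) : |Real.sinh t| ≤ 2 := by
  have h1 := Real.exp_le_exp.2 (abs_le.1 ht).2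
  have h2 := Real.exp_le_exp.2 (show -t ≤ 1 by linarith [(abs_le.1 ht).1])
  have h3 := Real.exp_one_lt_d9
  rw [Real.sinh_eq, abs_le]
  constructor <;> linarith [Real.exp_pos t, Real.exp_pos (-t)]

lemma cosh_le_three {t : ℝ} (ht : |t| ≤ 1) : Real.cosh t ≤ 3 := by
  have h1 := Real.exp_le_exp.2 (abs_le.1 ht).2
  have h2 := Real.exp_le_exp.2 (show -t ≤ 1 by linarith [(abs_le.1 ht).1])
  have h3 := Real.exp_one_lt_d9
  rw [Real.cosh_eq]
  linarith

lemma abs_cosh_mul_cubic_le {a b m t : ℝ} (ht : |t| ≤ 1) (hm : 1 ≤ m) (ha : |a| ≤ m)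
    (hb : |b| ≤ m) :
    |Real.cosh t * (60 * a - 1 + 480 * b * Real.sinh t + 243 * a * Real.sinh t ^ 2
      + 1024 * b * Real.sinh t ^ 3)| ≤ 50000 * m := by
  have hs := abs_sinh_le_two ht
  have mono : ∀ d : ℝ, |d| ≤ m → ∀ j : ℕ, |d * Real.sinh t ^ j| ≤ m * 2 ^ j := fun d hd j => by
    rw [abs_mul, abs_pow]
    gcongr
  have h1 := abs_le.1 (mono b hb 1)
  have h2 := abs_le.1 (mono a ha 2)
  have h3 := abs_le.1 (mono b hb 3)
  have h4 := abs_le.1 ha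
  have h : |60 * a - 1 + 480 * b * Real.sinh t + 243 * a * Real.sinh t ^ 2
      + 1024 * b * Real.sinh t ^ 3| ≤ 12000 * m := by
    rw [abs_le]
    constructor <;> linarith
  rw [abs_mul, abs_of_pos (Real.cosh_pos t)]
  calc _ ≤ 3 * (12000 * m) := by
        gcongr
        exact cosh_le_three ht
    _ ≤ _ := by linarith

/-- The substitution `u = sinh t` turns the argument of `Φ` into `x cosh t - sinh t`. -/
lemma exists_abs_gaussCDF_mul_cosh_sub_sinh_le :
    ∃ C > (0 : ℝ), ∀ x t : ℝ, |t| ≤ 1 →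
      |gaussCDF (x * Real.cosh t - Real.sinh t)
          - (gaussCDF x
              + (-Real.sinh t + (1/6) * Real.sinh t ^ 3 * (2 * x ^ 2 + 1)
                  + (1/12) * Real.sinh t ^ 4 * x * (x ^ 2 - 3)) * gaussPDF x)|
        ≤ C * |t| ^ 5 := by
  set K₁ := Real.exp (((9 : ℕ) : ℝ) ^ 2 / 2)
  set K₂ := Real.exp (((3 : ℕ) : ℝ) ^ 2 / 2)
  have hC : 0 < 116 * K₁ + 50000 * K₂ := by positivity
  refine ⟨116 * K₁ + 50000 * K₂, hC, fun x => ?_⟩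
  obtain ⟨a, ha⟩ : ∃ a, a = (2 * x ^ 2 + 1) / 6 := ⟨_, rfl⟩
  obtain ⟨b, hb⟩ : ∃ b, b = x * (x ^ 2 - 3) / 12 := ⟨_, rfl⟩
  set p := gaussPDF x with hp
  set S := Real.sinh
  set c := Real.cosh
  set y : ℝ → ℝ := fun t => x * c t - S t with hy
  set z : ℝ → ℝ := fun t => x * S t - c t with hz
  have dS : ∀ t, HasDerivAt S (c t) t := Real.hasDerivAt_sinh
  have dc : ∀ t, HasDerivAt c (S t) t := Real.hasDerivAt_cosh
  have dy : ∀ t, HasDerivAt y (z t) t := fun t => ((dc t).const_mul x).sub (dS t)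
  have dz : ∀ t, HasDerivAt z (y t) t := fun t => ((dS t).const_mul x).sub (dc t)
  have c2 : ∀ t, c t ^ 2 = S t ^ 2 + 1 := Real.cosh_sq
  have S0 : S 0 = 0 := Real.sinh_zero
  have c0 : c 0 = 1 := Real.cosh_zero
  have y0 : y 0 = x := by simp [hy, S0, c0]
  have z0 : z 0 = -1 := by simp [hz, S0, c0]
  set R0 : ℝ → ℝ := fun t => gaussCDF (y t) - (gaussCDF x
    + (-S t + a * S t ^ 3 + b * S t ^ 4) * p) with hR0
  set R1 : ℝ → ℝ := fun t => gaussPDF (y t) * z t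
    - c t * (-1 + 3 * a * S t ^ 2 + 4 * b * S t ^ 3) * p with hR1
  set R2 : ℝ → ℝ := fun t => gaussPDF (y t) * (y t - y t * z t ^ 2)
    - ((6 * a - 1) * S t + 12 * b * S t ^ 2 + 9 * a * S t ^ 3 + 16 * b * S t ^ 4) * p with hR2
  set R3 : ℝ → ℝ := fun t => gaussPDF (y t) *
      (z t - z t ^ 3 - 3 * y t ^ 2 * z t + y t ^ 2 * z t ^ 3)
    - c t * (6 * a - 1 + 24 * b * S t + 27 * a * S t ^ 2 + 64 * b * S t ^ 3) * p with hR3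
  set R4 : ℝ → ℝ := fun t => gaussPDF (y t) *
      (y t - 10 * y t * z t ^ 2 - 3 * y t ^ 3 + 6 * y t ^ 3 * z t ^ 2 + 3 * y t * z t ^ 4
        - y t ^ 3 * z t ^ 4)
    - (24 * b + (60 * a - 1) * S t + 240 * b * S t ^ 2 + 81 * a * S t ^ 3
        + 256 * b * S t ^ 4) * p with hR4
  set R5 : ℝ → ℝ := fun t => gaussPDF (y t) *
      (z t - 10 * z t ^ 3 + 3 * z t ^ 5 - 30 * y t ^ 2 * z t + 40 * y t ^ 2 * z t ^ 3
        - 6 * y t ^ 2 * z t ^ 5 + 15 * y t ^ 4 * z t - 10 * y t ^ 4 * z t ^ 3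
        + y t ^ 4 * z t ^ 5)
    - c t * (60 * a - 1 + 480 * b * S t + 243 * a * S t ^ 2 + 1024 * b * S t ^ 3) * p with hR5
  have d0 : ∀ t, HasDerivAt R0 (R1 t) t := fun t => by
    have h1 := (hasDerivAt_gaussCDF (y t)).comp t (dy t)
    have h2 := (((((dS t).neg.add (((dS t).pow 3).const_mul a)).add
      (((dS t).pow 4).const_mul b)).mul_const p).const_add (gaussCDF x))
    refine (h1.sub h2).congr_deriv ?_
    simp only [hR1]
    push_cast
    ring
  have d1 : ∀ t, HasDerivAt R1 (R2 t) t := fun t => by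
    have h1 := hasDerivAt_gaussPDF_mul (dy t) (dz t)
    have h2 := ((dc t).mul ((((((dS t).pow 2).const_mul (3 * a)).const_add (-1)).add
      (((dS t).pow 3).const_mul (4 * b))))).mul_const p
    refine (h1.sub h2).congr_deriv ?_
    simp only [hR2]
    push_cast
    simp only [Pi.add_apply, Pi.pow_apply]
    linear_combination -(6 * a * S t + 12 * b * S t ^ 2) * p * c2 t
  have d2 : ∀ t, HasDerivAt R2 (R3 t) t := fun t => by
    have h1 := hasDerivAt_gaussPDF_mul (dy t) ((dy t).sub ((dy t).mul ((dz t).pow 2)))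
    have h2 := (((((dS t).const_mul (6 * a - 1)).add (((dS t).pow 2).const_mul (12 * b))).add
      (((dS t).pow 3).const_mul (9 * a))).add (((dS t).pow 4).const_mul (16 * b))).mul_const p
    refine (h1.sub h2).congr_deriv ?_
    simp only [hR3]
    push_cast
    simp only [Pi.sub_apply, Pi.mul_apply, Pi.pow_apply]
    ring
  have d3 : ∀ t, HasDerivAt R3 (R4 t) t := fun t => by
    have h1 := hasDerivAt_gaussPDF_mul (dy t) ((((dz t).sub ((dz t).pow 3)).sub
      ((((dy t).pow 2).const_mul 3).mul (dz t))).add (((dy t).pow 2).mul ((dz t).pow 3)))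
    have h2 := ((dc t).mul ((((((dS t).const_mul (24 * b)).const_add (6 * a - 1)).add
      (((dS t).pow 2).const_mul (27 * a)))).add
      (((dS t).pow 3).const_mul (64 * b)))).mul_const p
    refine (h1.sub h2).congr_deriv ?_
    simp only [hR4]
    push_cast
    simp only [Pi.add_apply, Pi.sub_apply, Pi.mul_apply, Pi.pow_apply]
    linear_combination -(24 * b + 54 * a * S t + 192 * b * S t ^ 2) * p * c2 t
  have d4 : ∀ t, HasDerivAt R4 (R5 t) t := fun t => by
    have h1 := hasDerivAt_gaussPDF_mul (dy t) ((((((dy t).sub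
      (((dy t).const_mul 10).mul ((dz t).pow 2))).sub (((dy t).pow 3).const_mul 3)).add
      ((((dy t).pow 3).const_mul 6).mul ((dz t).pow 2))).add
      (((dy t).const_mul 3).mul ((dz t).pow 4))).sub (((dy t).pow 3).mul ((dz t).pow 4)))
    have h2 := ((((((dS t).const_mul (60 * a - 1)).const_add (24 * b)).add
      (((dS t).pow 2).const_mul (240 * b))).add (((dS t).pow 3).const_mul (81 * a))).add
      (((dS t).pow 4).const_mul (256 * b))).mul_const p
    refine (h1.sub h2).congr_deriv ?_
    simp only [hR5]
    push_cast
    simp only [Pi.add_apply, Pi.sub_apply, Pi.mul_apply, Pi.pow_apply]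
    ring
  have b5 : ∀ t, |t| ≤ 1 → |R5 t| ≤ (116 * K₁ + 50000 * K₂) * |t| ^ 0 := fun t ht => by
    have hx0 := abs_nonneg x
    have hxx := sq_abs x
    have hma : |a| ≤ (1 + |x|) ^ 3 := by
      rw [ha, abs_of_nonneg (by positivity)]
      nlinarith [pow_nonneg hx0 3]
    have hmb : |b| ≤ (1 + |x|) ^ 3 := by
      have h3 : |x ^ 2 - 3| ≤ |x| ^ 2 + 3 := by
        rw [abs_le]
        constructor <;> nlinarith
      rw [hb, abs_div, abs_mul, abs_of_pos (by norm_num : (0 : ℝ) < 12)]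
      nlinarith [pow_nonneg hx0 3, mul_le_mul_of_nonneg_left h3 hx0]
    have e1 := abs_quintic_le (m := 1 + |y t|) (by linarith [abs_nonneg (y t)])
      (by linarith : |y t| ≤ 1 + |y t|) (abs_mul_sinh_sub_cosh_le x t)
    have e2 := abs_cosh_mul_cubic_le ht (one_le_pow₀ (by linarith)) hma hmb
    have g1 : _ ≤ K₁ := one_add_abs_pow_mul_gaussPDF_le 9 (y t)
    have g2 : _ ≤ K₂ := one_add_abs_pow_mul_gaussPDF_le 3 x
    rw [pow_zero, mul_one]
    refine (abs_sub _ _).trans (add_le_add ?_ ?_)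
    · rw [abs_mul, abs_of_pos (gaussPDF_pos _)]
      refine (mul_le_mul_of_nonneg_left e1 (gaussPDF_pos _).le).trans ?_
      linarith
    · rw [abs_mul, abs_of_pos (gaussPDF_pos x)]
      refine (mul_le_mul_of_nonneg_right e2 (gaussPDF_pos x).le).trans ?_
      linarith
  have b4 := abs_le_mul_abs_pow_succ 0 hC.le
    (by simp only [hR4, S0, y0, z0, hb, ← hp]; ring) d4 b5
  have b3 := abs_le_mul_abs_pow_succ 1 hC.le
    (by simp only [hR3, S0, c0, y0, z0, ha, ← hp]; ring) d3 b4
  have b2 := abs_le_mul_abs_pow_succ 2 hC.le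
    (by simp only [hR2, S0, y0, z0]; ring) d2 b3
  have b1 := abs_le_mul_abs_pow_succ 3 hC.le
    (by simp only [hR1, S0, c0, y0, z0, ← hp]; ring) d1 b2
  have b0 := abs_le_mul_abs_pow_succ 4 hC.le
    (by simp only [hR0, S0, y0]; ring) d0 b1
  intro t ht
  convert b0 t ht using 2
  simp only [hR0, ha, hb]
  ring

lemma abs_arsinh_le (u : ℝ) : |Real.arsinh u| ≤ |u| := by
  have h := Real.self_le_sinh_iff.2 (abs_nonneg (Real.arsinh u))
  rcases abs_cases (Real.arsinh u) with ⟨h1, -⟩ | ⟨h1, -⟩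
  · rw [h1, Real.sinh_arsinh] at h
    rw [h1]; exact h.trans (le_abs_self u)
  · rw [h1, Real.sinh_neg, Real.sinh_arsinh] at h
    rw [h1]; exact h.trans (neg_le_abs u)

/-- There is an absolute constant `C > 0` such that for all `|u| ≤ 1` and all `x`,
`|Φ(x (1 + u²)^{1/2} − u) − [Φ(x) + (−u + (1/6) u³ (2x² + 1) + (1/12) u⁴ x (x² − 3)) φ(x)]|
  ≤ C |u|⁵`. -/
theorem statement19 :
    ∃ C > (0:ℝ), ∀ u x : ℝ, |u| ≤ 1 →
      |gaussCDF (x * Real.sqrt (1 + u ^ 2) - u)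
          - (gaussCDF x
              + (-u + (1/6) * u ^ 3 * (2 * x ^ 2 + 1) + (1/12) * u ^ 4 * x * (x ^ 2 - 3))
                  * gaussPDF x)|
        ≤ C * |u| ^ 5 := by
  obtain ⟨C, hC, h⟩ := exists_abs_gaussCDF_mul_cosh_sub_sinh_le
  refine ⟨C, hC, fun u x hu => ?_⟩
  have ht := abs_arsinh_le u
  have := h x (Real.arsinh u) (ht.trans hu)
  rw [Real.sinh_arsinh, Real.cosh_arsinh] at this
  exact this.trans (by gcongr)
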